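/- arXiv:2601.06005 — 3 statements merged into one kernel-verified Lean document; each statement's English description precedes it below -/
import Mathlib

section
/- For every n ≥ 1, all Hermitian matrices x, y ∈ M_n(ℂ), and every continuously differentiable function φ : ℝ → ℝ such that ψ := (φ′)² is convex on ℝ, one has Tr[(φ(x) − φ(y))²] ≤ (1/2)·Tr[(x − y)²·(ψ(x) + ψ(y))]. -/
open Matrix

/-- The pointwise form of the Klein inequality: the squared increment of `φ` is controlled by the
average of the convex function `(φ')²` over the two endpoints. -/
lemma sq_sub_le_of_convexOn_sq_deriv {φ : ℝ → ℝ} (hφ : Differentiable ℝ φ)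
    (hψ : ConvexOn ℝ Set.univ (fun s : ℝ => (deriv φ s) ^ 2)) (a b : ℝ) :
    (φ a - φ b) ^ 2 ≤ (1 / 2) * ((a - b) ^ 2 * ((deriv φ a) ^ 2 + (deriv φ b) ^ 2)) := by
  set D := φ b - φ a with hD
  set h := b - a with hh
  set p := (deriv φ a) ^ 2 with hp
  set q := (deriv φ b) ^ 2 with hq
  let F : ℝ → ℝ := fun s =>
    2 * D * φ (a + s * h) - D ^ 2 * s - h ^ 2 * (p * s + (q - p) * (s ^ 2 / 2))
  have hF (s : ℝ) : HasDerivAt F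
      (2 * D * (deriv φ (a + s * h) * h) - D ^ 2 - h ^ 2 * (p + (q - p) * s)) s := by
    have h1 : HasDerivAt (fun s : ℝ => a + s * h) h s := by
      simpa using ((hasDerivAt_id s).mul_const h).const_add a
    have h2 : HasDerivAt (fun s => φ (a + s * h)) (deriv φ (a + s * h) * h) s :=
      (hφ _).hasDerivAt.comp s h1
    have h3 : HasDerivAt (fun s : ℝ => s ^ 2 / 2) s s := by
      simpa using (hasDerivAt_pow 2 s).div_const 2
    have h4 := ((hasDerivAt_id s).const_mul p).add (h3.const_mul (q - p))
    have h5 := ((h2.const_mul (2 * D)).sub ((hasDerivAt_id s).const_mul (D ^ 2))).sub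
      (h4.const_mul (h ^ 2))
    rw [mul_one, mul_one] at h5
    exact h5
  have hanti : AntitoneOn F (Set.Icc 0 1) := by
    refine antitoneOn_of_deriv_nonpos (convex_Icc 0 1)
      (fun s _ => (hF s).continuousAt.continuousWithinAt)
      (fun s _ => (hF s).differentiableAt.differentiableWithinAt) fun s hs => ?_
    rw [interior_Icc] at hs
    rw [(hF s).deriv]
    have hc := hψ.2 (Set.mem_univ a) (Set.mem_univ b) (sub_nonneg.2 hs.2.le) hs.1.le
      (sub_add_cancel 1 s)
    have hpt : (1 - s) • a + s • b = a + s * h := by simp only [smul_eq_mul, hh]; ring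
    rw [hpt] at hc
    simp only [smul_eq_mul, ← hp, ← hq] at hc
    nlinarith [mul_le_mul_of_nonneg_left hc (sq_nonneg h),
      sq_nonneg (D - h * deriv φ (a + s * h))]
  have key := hanti (by simp) (by simp) (zero_le_one' ℝ)
  have hb : a + 1 * h = b := by simp [hh]
  simp only [F, hb, zero_mul, add_zero] at key
  have e1 : φ a = φ b - D := by rw [hD]; ring
  have e2 : a - b = -h := by rw [hh]; ring
  rw [e2]
  rw [e1] at key ⊢
  nlinarith [key]

section

variable {n : Type*} [Fintype n] [DecidableEq n]

/-- For unitary `U`, `V` and real diagonal matrices, a weighted trace of the squared difference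
expands in the squared moduli of the overlaps `(Uᴴ V) i j`. -/
lemma trace_sq_sub_mul_of_unitary (U V : unitary (Matrix n n ℂ)) (d e g : n → ℝ) :
    ((((U : Matrix n n ℂ) * diagonal (fun i => (d i : ℂ)) * star (U : Matrix n n ℂ) -
        (V : Matrix n n ℂ) * diagonal (fun i => (e i : ℂ)) * star (V : Matrix n n ℂ)) ^ 2 *
        ((U : Matrix n n ℂ) * diagonal (fun i => (g i : ℂ)) * star (U : Matrix n n ℂ))).trace).re =
      ∑ i, ∑ j, Complex.normSq ((star (U : Matrix n n ℂ) * (V : Matrix n n ℂ)) i j) *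
        ((d i - e j) ^ 2 * g i) := by
  have hU : star (U : Matrix n n ℂ) * (U : Matrix n n ℂ) = 1 := Unitary.coe_star_mul_self U
  have hV : star (V : Matrix n n ℂ) * (V : Matrix n n ℂ) = 1 := Unitary.coe_star_mul_self V
  have hV' : (V : Matrix n n ℂ) * star (V : Matrix n n ℂ) = 1 := Unitary.coe_mul_star_self V
  generalize (U : Matrix n n ℂ) = u at *
  generalize (V : Matrix n n ℂ) = v at *
  have hdiag (f : n → ℝ) : star (diagonal fun i => (f i : ℂ)) = diagonal fun i => (f i : ℂ) := by
    rw [star_eq_conjTranspose, diagonal_conjTranspose]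
    congr 1
    ext i
    simp
  set H := u * diagonal (fun i => (d i : ℂ)) * star u -
    v * diagonal (fun i => (e i : ℂ)) * star v with hH
  have hHs : star H = H := by
    simp only [hH, star_sub, star_mul, star_star, hdiag, mul_assoc]
  set M := star u * H * v with hM
  have hM' : M = diagonal (fun i => (d i : ℂ)) * (star u * v) -
      (star u * v) * diagonal (fun i => (e i : ℂ)) := by
    calc M = (star u * u) * diagonal (fun i => (d i : ℂ)) * (star u * v) -
        (star u * v) * diagonal (fun i => (e i : ℂ)) * (star v * v) := by
          rw [hM, hH]; noncomm_ring
      _ = _ := by rw [hU, hV, one_mul, mul_one]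
  have hMs : M * star M = star u * H ^ 2 * u := by
    calc M * star M = star u * H * (v * star v) * H * u := by
          simp only [hM, star_mul, star_star, hHs, mul_assoc]
      _ = _ := by rw [hV', mul_one, pow_two, mul_assoc (star u)]
  have htr : (H ^ 2 * (u * diagonal (fun i => (g i : ℂ)) * star u)).trace =
      (M * star M * diagonal (fun i => (g i : ℂ))).trace := by
    rw [hMs, ← mul_assoc, trace_mul_comm]
    simp only [mul_assoc]
  have hentry (i j : n) : M i j = ((d i - e j : ℝ) : ℂ) * (star u * v) i j := by
    rw [hM', Matrix.sub_apply, diagonal_mul, mul_diagonal]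
    push_cast
    ring
  rw [htr, trace, Complex.re_sum]
  refine Finset.sum_congr rfl fun i _ => ?_
  rw [diag_apply, mul_diagonal, mul_apply, Finset.sum_mul, Complex.re_sum]
  refine Finset.sum_congr rfl fun j _ => ?_
  rw [star_apply, hentry, Complex.star_def, Complex.mul_conj, ← Complex.ofReal_mul,
    Complex.ofReal_re, Complex.normSq_mul, Complex.normSq_ofReal]
  ring

/-- Spectral expansion of `Tr[(f(x) - f(y))² g(x)]` for Hermitian `x` and `y`. -/
lemma Matrix.IsHermitian.trace_sq_cfc_sub_mul_cfc {x y : Matrix n n ℂ} (hx : x.IsHermitian)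
    (hy : y.IsHermitian) (f g : ℝ → ℝ) :
    (((cfc f x - cfc f y) ^ 2 * cfc g x).trace).re =
      ∑ i, ∑ j, Complex.normSq ((star (hx.eigenvectorUnitary : Matrix n n ℂ) *
        (hy.eigenvectorUnitary : Matrix n n ℂ)) i j) *
        ((f (hx.eigenvalues i) - f (hy.eigenvalues j)) ^ 2 * g (hx.eigenvalues i)) := by
  rw [hx.cfc_eq, hx.cfc_eq, hy.cfc_eq]
  exact trace_sq_sub_mul_of_unitary hx.eigenvectorUnitary hy.eigenvectorUnitary
    (f ∘ hx.eigenvalues) (f ∘ hy.eigenvalues) (g ∘ hx.eigenvalues)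

end

/-- **Generalized Klein inequality** (finite-dimensional case, Lemma 4.1):
for Hermitian matrices `x, y ∈ Mₙ(ℂ)` and `φ : ℝ → ℝ` continuously differentiable
with `ψ := (φ')²` convex, one has
`Tr[(φ(x) − φ(y))²] ≤ (1/2)·Tr[(x − y)²·(ψ(x) + ψ(y))]`,
where functional calculus on Hermitian matrices is denoted by `cfc`. -/
theorem generalized_klein_inequality (n : ℕ) (hn : 1 ≤ n)
    (x y : Matrix (Fin n) (Fin n) ℂ) (hx : x.IsHermitian) (hy : y.IsHermitian)
    (φ : ℝ → ℝ) (hφ : ContDiff ℝ 1 φ)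
    (hψ : ConvexOn ℝ Set.univ (fun s : ℝ => (deriv φ s) ^ 2)) :
    (Matrix.trace ((cfc φ x - cfc φ y) ^ 2)).re ≤
      (1 / 2) * (Matrix.trace ((x - y) ^ 2 *
        (cfc (fun s : ℝ => (deriv φ s) ^ 2) x +
         cfc (fun s : ℝ => (deriv φ s) ^ 2) y))).re := by
  set ψ : ℝ → ℝ := fun s => (deriv φ s) ^ 2 with hψ_def
  have hl := hx.trace_sq_cfc_sub_mul_cfc hy φ (fun _ => 1)
  have h1 := hx.trace_sq_cfc_sub_mul_cfc hy (fun s => s) ψ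
  have h2 := hy.trace_sq_cfc_sub_mul_cfc hx (fun s => s) ψ
  have hxs : IsSelfAdjoint x := hx
  have hys : IsSelfAdjoint y := hy
  rw [cfc_const_one ℝ x, mul_one] at hl
  rw [cfc_id' ℝ x, cfc_id' ℝ y] at h1 h2
  have hsq : (y - x) ^ 2 = (x - y) ^ 2 := by rw [← neg_sub x y, neg_sq]
  rw [hsq, Finset.sum_comm] at h2
  have hov (i j : Fin n) :
      Complex.normSq ((star (hy.eigenvectorUnitary : Matrix (Fin n) (Fin n) ℂ) *
        (hx.eigenvectorUnitary : Matrix (Fin n) (Fin n) ℂ)) j i) =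
      Complex.normSq ((star (hx.eigenvectorUnitary : Matrix (Fin n) (Fin n) ℂ) *
        (hy.eigenvectorUnitary : Matrix (Fin n) (Fin n) ℂ)) i j) := by
    rw [← Complex.normSq_conj, ← Complex.star_def, ← star_apply, star_mul, star_star]
  simp only [hov] at h2
  rw [mul_add, trace_add, Complex.add_re, hl, h1, h2]
  simp only [← Finset.sum_add_distrib, Finset.mul_sum]
  refine Finset.sum_le_sum fun i _ => Finset.sum_le_sum fun j _ => ?_
  have hs := sq_sub_le_of_convexOn_sq_deriv (hφ.differentiable one_ne_zero) hψ
    (hx.eigenvalues i) (hy.eigenvalues j)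
  refine (mul_le_mul_of_nonneg_left ((mul_one _).trans_le hs) (Complex.normSq_nonneg _)).trans_eq ?_
  simp only [hψ_def]
  ring
end

section
/- Let d₁, d₂ ≥ 1, t ≥ 0 and α₁, α₂ > 0. For i = 1, 2 let A_i, P_i ∈ M_{d_i}(ℂ) be such that P_i is an orthogonal projection (P_iᴴ = P_i = P_i²), A_i·P_i = P_i·A_i = P_i, ‖A_i v‖ ≤ ‖v‖ for all v ∈ ℂ^{d_i}, and ‖A_i v − P_i v‖ ≤ e^{−α_i t}·‖v − P_i v‖ for all v ∈ ℂ^{d_i}. Then for every w ∈ ℂ^{d₁·d₂} one has ‖(A₁ ⊗ A₂)·w − (P₁ ⊗ P₂)·w‖ ≤ e^{−min(α₁,α₂)·t}·‖w − (P₁ ⊗ P₂)·w‖, where ⊗ denotes the Kronecker product and all norms are Euclidean (ℓ²) norms. -/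
open Matrix
open scoped Kronecker

/-- The Euclidean (ℓ²) norm of a complex vector. -/
noncomputable def l2norm {n : Type*} [Fintype n] (v : n → ℂ) : ℝ :=
  Real.sqrt (∑ i, ‖v i‖ ^ 2)

section Kronecker

lemma Matrix.sub_kronecker {l m n p R : Type*} [NonUnitalNonAssocRing R]
    (A B : Matrix l m R) (C : Matrix n p R) : (A - B) ⊗ₖ C = A ⊗ₖ C - B ⊗ₖ C := by
  ext
  simp [sub_mul]

lemma Matrix.kronecker_sub {l m n p R : Type*} [NonUnitalNonAssocRing R]
    (A : Matrix l m R) (B C : Matrix n p R) : A ⊗ₖ (B - C) = A ⊗ₖ B - A ⊗ₖ C := by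
  ext
  simp [mul_sub]

variable {m n : Type*} [Fintype m] [Fintype n]

lemma l2norm_nonneg (v : n → ℂ) : 0 ≤ l2norm v :=
  Real.sqrt_nonneg _

lemma l2norm_sq (v : n → ℂ) : l2norm v ^ 2 = ∑ i, ‖v i‖ ^ 2 :=
  Real.sq_sqrt (Finset.sum_nonneg fun _ _ => sq_nonneg _)

lemma ofReal_l2norm_sq (v : n → ℂ) : ((l2norm v ^ 2 : ℝ) : ℂ) = star v ⬝ᵥ v := by
  rw [l2norm_sq, dotProduct]
  push_cast
  exact Finset.sum_congr rfl fun i _ => (Complex.conj_mul' (v i)).symm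

lemma l2norm_sq_add_of_dotProduct_eq_zero {x y : n → ℂ} (h : star x ⬝ᵥ y = 0) :
    l2norm (x + y) ^ 2 = l2norm x ^ 2 + l2norm y ^ 2 := by
  have h' : star y ⬝ᵥ x = 0 := by rw [star_dotProduct, h, star_zero]
  rw [← Complex.ofReal_inj]
  push_cast [ofReal_l2norm_sq]
  simp only [← Complex.ofReal_pow, ofReal_l2norm_sq]
  rw [star_add, add_dotProduct, dotProduct_add, dotProduct_add, h, h', add_zero, zero_add]

/-- Pythagoras' theorem for an orthogonal projection. -/
lemma l2norm_sq_eq_add_of_isHermitian_of_idem {P : Matrix n n ℂ} (hP : Pᴴ = P)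
    (hPP : P * P = P) (v : n → ℂ) :
    l2norm v ^ 2 = l2norm (P *ᵥ v) ^ 2 + l2norm (v - P *ᵥ v) ^ 2 := by
  rw [← l2norm_sq_add_of_dotProduct_eq_zero, add_sub_cancel]
  rw [star_mulVec, hP, ← dotProduct_mulVec, mulVec_sub, mulVec_mulVec, hPP, sub_self,
    dotProduct_zero]

lemma one_kronecker_mulVec_apply [DecidableEq m] (M : Matrix n n ℂ) (w : m × n → ℂ)
    (i : m) (j : n) :
    (((1 : Matrix m m ℂ) ⊗ₖ M) *ᵥ w) (i, j) = (M *ᵥ fun k => w (i, k)) j := by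
  simp [mulVec, dotProduct, Fintype.sum_prod_type, one_apply]

lemma kronecker_one_mulVec_apply [DecidableEq n] (M : Matrix m m ℂ) (w : m × n → ℂ)
    (i : m) (j : n) :
    ((M ⊗ₖ (1 : Matrix n n ℂ)) *ᵥ w) (i, j) = (M *ᵥ fun k => w (k, j)) i := by
  simp [mulVec, dotProduct, Fintype.sum_prod_type, one_apply]

lemma l2norm_one_kronecker_mulVec_sq_le [DecidableEq m] {M N : Matrix n n ℂ} {c : ℝ}
    (h : ∀ v, l2norm (M *ᵥ v) ≤ c * l2norm (N *ᵥ v)) (w : m × n → ℂ) :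
    l2norm (((1 : Matrix m m ℂ) ⊗ₖ M) *ᵥ w) ^ 2 ≤
      c ^ 2 * l2norm (((1 : Matrix m m ℂ) ⊗ₖ N) *ᵥ w) ^ 2 := by
  simp only [l2norm_sq, Fintype.sum_prod_type, one_kronecker_mulVec_apply]
  simp only [← l2norm_sq, Finset.mul_sum, ← mul_pow]
  exact Finset.sum_le_sum fun i _ => pow_le_pow_left₀ (l2norm_nonneg _) (h _) 2

lemma l2norm_kronecker_one_mulVec_sq_le [DecidableEq n] {M N : Matrix m m ℂ} {c : ℝ}
    (h : ∀ v, l2norm (M *ᵥ v) ≤ c * l2norm (N *ᵥ v)) (w : m × n → ℂ) :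
    l2norm ((M ⊗ₖ (1 : Matrix n n ℂ)) *ᵥ w) ^ 2 ≤
      c ^ 2 * l2norm ((N ⊗ₖ (1 : Matrix n n ℂ)) *ᵥ w) ^ 2 := by
  simp only [l2norm_sq, Fintype.sum_prod_type_right, kronecker_one_mulVec_apply]
  simp only [← l2norm_sq, Finset.mul_sum, ← mul_pow]
  exact Finset.sum_le_sum fun i _ => pow_le_pow_left₀ (l2norm_nonneg _) (h _) 2

end Kronecker

/-- **Spectral gap of a tensor product** (Proposition B.1, finite-dimensional form):
if `A_i` are contractions fixing the orthogonal projections `P_i` and converging to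
them at exponential rates `α_i`, then the Kronecker product `A₁ ⊗ A₂` converges to
`P₁ ⊗ P₂` at rate `min(α₁, α₂)`. -/
theorem kronecker_spectral_gap (d₁ d₂ : ℕ) (hd₁ : 1 ≤ d₁) (hd₂ : 1 ≤ d₂)
    (t : ℝ) (ht : 0 ≤ t) (α₁ α₂ : ℝ) (hα₁ : 0 < α₁) (hα₂ : 0 < α₂)
    (A₁ P₁ : Matrix (Fin d₁) (Fin d₁) ℂ) (A₂ P₂ : Matrix (Fin d₂) (Fin d₂) ℂ)
    (hP₁herm : P₁ᴴ = P₁) (hP₁idem : P₁ * P₁ = P₁)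
    (hP₂herm : P₂ᴴ = P₂) (hP₂idem : P₂ * P₂ = P₂)
    (hAP₁ : A₁ * P₁ = P₁) (hPA₁ : P₁ * A₁ = P₁)
    (hAP₂ : A₂ * P₂ = P₂) (hPA₂ : P₂ * A₂ = P₂)
    (hA₁contr : ∀ v : Fin d₁ → ℂ, l2norm (A₁.mulVec v) ≤ l2norm v)
    (hA₂contr : ∀ v : Fin d₂ → ℂ, l2norm (A₂.mulVec v) ≤ l2norm v)
    (hA₁gap : ∀ v : Fin d₁ → ℂ,
      l2norm (A₁.mulVec v - P₁.mulVec v) ≤ Real.exp (-α₁ * t) * l2norm (v - P₁.mulVec v))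
    (hA₂gap : ∀ v : Fin d₂ → ℂ,
      l2norm (A₂.mulVec v - P₂.mulVec v) ≤ Real.exp (-α₂ * t) * l2norm (v - P₂.mulVec v)) :
    ∀ w : Fin d₁ × Fin d₂ → ℂ,
      l2norm ((A₁ ⊗ₖ A₂).mulVec w - (P₁ ⊗ₖ P₂).mulVec w) ≤
        Real.exp (-(min α₁ α₂) * t) * l2norm (w - (P₁ ⊗ₖ P₂).mulVec w) := by
  intro w
  set c := Real.exp (-(min α₁ α₂) * t)
  have hc : 0 ≤ c := (Real.exp_pos _).le
  have hc₁ : Real.exp (-α₁ * t) ≤ c :=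
    Real.exp_le_exp.2 (mul_le_mul_of_nonneg_right (neg_le_neg (min_le_left _ _)) ht)
  have hc₂ : Real.exp (-α₂ * t) ≤ c :=
    Real.exp_le_exp.2 (mul_le_mul_of_nonneg_right (neg_le_neg (min_le_right _ _)) ht)
  have gap₁ (v : Fin d₁ → ℂ) : l2norm ((A₁ - P₁) *ᵥ v) ≤ c * l2norm ((1 - P₁) *ᵥ v) := by
    rw [sub_mulVec, sub_mulVec, one_mulVec]
    exact (hA₁gap v).trans (mul_le_mul_of_nonneg_right hc₁ (l2norm_nonneg _))
  have gap₂ (v : Fin d₂ → ℂ) : l2norm ((A₂ - P₂) *ᵥ v) ≤ c * l2norm ((1 - P₂) *ᵥ v) := by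
    rw [sub_mulVec, sub_mulVec, one_mulVec]
    exact (hA₂gap v).trans (mul_le_mul_of_nonneg_right hc₂ (l2norm_nonneg _))
  have contr₂ (v : Fin d₂ → ℂ) :
      l2norm (A₂ *ᵥ v) ≤ 1 * l2norm ((1 : Matrix (Fin d₂) (Fin d₂) ℂ) *ᵥ v) := by
    simpa using hA₂contr v
  let Q : Matrix (Fin d₁ × Fin d₂) (Fin d₁ × Fin d₂) ℂ := P₁ ⊗ₖ 1
  have hQ : Qᴴ = Q := by simp [Q, conjTranspose_kronecker, hP₁herm]
  have hQQ : Q * Q = Q := by simp [Q, ← mul_kronecker_mul, hP₁idem]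
  refine (sq_le_sq₀ (l2norm_nonneg _) (mul_nonneg hc (l2norm_nonneg _))).1 ?_
  rw [mul_pow, l2norm_sq_eq_add_of_isHermitian_of_idem hQ hQQ,
    l2norm_sq_eq_add_of_isHermitian_of_idem hQ hQQ (w - _), mul_add]
  refine add_le_add ?_ ?_
  · have hA : Q *ᵥ ((A₁ ⊗ₖ A₂) *ᵥ w - (P₁ ⊗ₖ P₂) *ᵥ w) = (1 ⊗ₖ (A₂ - P₂)) *ᵥ (Q *ᵥ w) := by
      simp [Q, mulVec_sub, ← mul_kronecker_mul, sub_mul, sub_mulVec, kronecker_sub,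
        hP₁idem, hPA₁]
    have hI : Q *ᵥ (w - (P₁ ⊗ₖ P₂) *ᵥ w) = (1 ⊗ₖ (1 - P₂)) *ᵥ (Q *ᵥ w) := by
      simp [Q, mulVec_sub, ← mul_kronecker_mul, sub_mul, sub_mulVec, kronecker_sub,
        hP₁idem]
    rw [hA, hI]
    exact l2norm_one_kronecker_mulVec_sq_le gap₂ _
  · have h := l2norm_one_kronecker_mulVec_sq_le (m := Fin d₁) contr₂
      (((A₁ - P₁) ⊗ₖ (1 : Matrix (Fin d₂) (Fin d₂) ℂ)) *ᵥ w)
    have h' := l2norm_kronecker_one_mulVec_sq_le (n := Fin d₂) gap₁ w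
    rw [one_pow, one_mul, one_kronecker_one, one_mulVec] at h
    have hA : (A₁ ⊗ₖ A₂) *ᵥ w - (P₁ ⊗ₖ P₂) *ᵥ w - Q *ᵥ ((A₁ ⊗ₖ A₂) *ᵥ w - (P₁ ⊗ₖ P₂) *ᵥ w) =
        (1 ⊗ₖ A₂) *ᵥ (((A₁ - P₁) ⊗ₖ 1) *ᵥ w) := by
      simp [Q, mulVec_sub, ← mul_kronecker_mul, sub_mulVec, sub_kronecker, hP₁idem, hPA₁]
    have hI : w - (P₁ ⊗ₖ P₂) *ᵥ w - Q *ᵥ (w - (P₁ ⊗ₖ P₂) *ᵥ w) = ((1 - P₁) ⊗ₖ 1) *ᵥ w := by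
      simp [Q, mulVec_sub, ← mul_kronecker_mul, sub_mulVec, sub_kronecker, hP₁idem]
    rw [hA, hI]
    exact h.trans h'
end

section
/- Let d, n ≥ 1, let a₁, …, a_n ∈ M_d(ℂ), and let p be a real number with p = 2 or p ≥ 3. Then (2^{−n}·Σ_{ε ∈ {−1,1}^n} Tr(((Σ_{i=1}^n ε_i a_i)ᴴ·(Σ_{i=1}^n ε_i a_i))^{p/2}))^{1/p} ≤ (p/√2)·(‖(Σ_{i=1}^n a_iᴴ a_i)^{1/2}‖_{S_p} + ‖(Σ_{i=1}^n a_i a_iᴴ)^{1/2}‖_{S_p}). -/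
open Matrix

/-- Real power of a matrix through functional calculus on the eigenvalues. -/
noncomputable def mpow (d : ℕ) (a : Matrix (Fin d) (Fin d) ℂ) (r : ℝ) :
    Matrix (Fin d) (Fin d) ℂ :=
  cfc (fun s : ℝ => s ^ r) a

/-- The Schatten `p`-norm `‖a‖_{S_p} = (Tr((aᴴa)^{p/2}))^{1/p}` on `M_d(ℂ)`
(unnormalized trace). -/
noncomputable def schattenNorm (d : ℕ) (p : ℝ) (a : Matrix (Fin d) (Fin d) ℂ) : ℝ :=
  (Matrix.trace (mpow d (aᴴ * a) (p / 2))).re ^ (1 / p)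

section ComplexOrder

open scoped ComplexOrder

section SpectralTraces

variable {m : Type*} [Fintype m] [DecidableEq m]

/-- Every real function is continuous on the finite spectrum of a matrix. -/
lemma continuousOn_spectrum_real (A : Matrix m m ℂ) (f : ℝ → ℝ) :
    ContinuousOn f (spectrum ℝ A) :=
  (finite_real_spectrum (A := A)).continuousOn f

lemma trace_cfc_eq_sum {A : Matrix m m ℂ} (hA : A.IsHermitian) (f : ℝ → ℝ) :
    ((cfc f A).trace).re = ∑ i, f (hA.eigenvalues i) := by
  rw [hA.cfc_eq, IsHermitian.cfc, Unitary.conjStarAlgAut_apply, Matrix.trace_mul_cycle,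
    Unitary.coe_star_mul_self, one_mul, trace_diagonal]
  simp

lemma trace_cfc_eq_sum_roots {A : Matrix m m ℂ} (hA : A.IsHermitian) (f : ℝ → ℝ) :
    ((cfc f A).trace).re = (A.charpoly.roots.map fun z => f z.re).sum := by
  rw [trace_cfc_eq_sum hA, hA.roots_charpoly_eq_eigenvalues, Multiset.map_map]
  simp

lemma trace_cfc_nonneg {A : Matrix m m ℂ} (hA : A.PosSemidef) {f : ℝ → ℝ}
    (hf : ∀ x, 0 ≤ x → 0 ≤ f x) : 0 ≤ ((cfc f A).trace).re := by
  rw [trace_cfc_eq_sum hA.isHermitian]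
  exact Finset.sum_nonneg fun i _ => hf _ (hA.eigenvalues_nonneg i)

/-- The trace of a block diagonal functional calculus is the sum of the traces of the blocks. -/
lemma trace_cfc_fromBlocks {k : Type*} [Fintype k] [DecidableEq k]
    {A : Matrix m m ℂ} {B : Matrix k k ℂ}
    (hA : A.IsHermitian) (hB : B.IsHermitian) (f : ℝ → ℝ) :
    ((cfc f (fromBlocks A 0 0 B)).trace).re = ((cfc f A).trace).re + ((cfc f B).trace).re := by
  have h0 : (fromBlocks A 0 0 B).IsHermitian := hA.fromBlocks (by simp) hB
  rw [trace_cfc_eq_sum_roots h0, trace_cfc_eq_sum_roots hA, trace_cfc_eq_sum_roots hB,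
    charpoly_fromBlocks_zero₁₂, Polynomial.roots_mul, Multiset.map_add, Multiset.sum_add]
  exact mul_ne_zero (charpoly_monic A).ne_zero (charpoly_monic B).ne_zero

/-- Simultaneous spectral expansion of `Tr (f(A) g(B))` with nonnegative weights. -/
lemma exists_weights_trace_cfc_mul_cfc {A B : Matrix m m ℂ}
    (hA : A.IsHermitian) (hB : B.IsHermitian) :
    ∃ w : m → m → ℝ, (∀ j k, 0 ≤ w j k) ∧ ∀ f g : ℝ → ℝ,
      ((cfc f A * cfc g B).trace).re =
        ∑ j, ∑ k, w j k * (f (hA.eigenvalues j) * g (hB.eigenvalues k)) := by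
  set U : Matrix m m ℂ := hA.eigenvectorUnitary.1
  set V : Matrix m m ℂ := hB.eigenvectorUnitary.1
  set W : Matrix m m ℂ := Uᴴ * V with hW
  refine ⟨fun j k => Complex.normSq (W j k), fun j k => Complex.normSq_nonneg _, fun f g => ?_⟩
  have hWs : Wᴴ = Vᴴ * U := by simp [hW]
  have h : (cfc f A * cfc g B).trace =
      (diagonal (fun j => (f (hA.eigenvalues j) : ℂ)) * W *
        diagonal (fun k => (g (hB.eigenvalues k) : ℂ)) * Wᴴ).trace := by
    rw [hA.cfc_eq, hB.cfc_eq, IsHermitian.cfc, IsHermitian.cfc, Unitary.conjStarAlgAut_apply,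
      Unitary.conjStarAlgAut_apply, hWs, hW]
    simp only [star_eq_conjTranspose]
    rw [mul_assoc, mul_assoc, Matrix.trace_mul_comm]
    simp only [mul_assoc]
    rfl
  rw [h, Matrix.trace, Complex.re_sum]
  refine Finset.sum_congr rfl fun j _ => ?_
  rw [Matrix.diag_apply, Matrix.mul_apply, Complex.re_sum]
  refine Finset.sum_congr rfl fun k _ => ?_
  rw [mul_diagonal, diagonal_mul, conjTranspose_apply, Complex.star_def,
    show (f (hA.eigenvalues j) : ℂ) * W j k * (g (hB.eigenvalues k)) * (starRingEnd ℂ) (W j k) =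
      (f (hA.eigenvalues j)) * (g (hB.eigenvalues k)) * (W j k * (starRingEnd ℂ) (W j k)) by ring,
    Complex.mul_conj]
  norm_cast
  ring

end SpectralTraces

section ScalarInequalities

lemma mul_rpow_sub_rpow_le {q a b : ℝ} (hq : 0 ≤ q) (hb : 0 ≤ b) (hba : b ≤ a) :
    b * (a ^ q - b ^ q) ≤ q * (a - b) * a ^ q := by
  rcases (hb.trans hba).eq_or_lt with rfl | ha
  · obtain rfl : b = 0 := le_antisymm hba hb
    simp
  have h := one_add_mul_self_le_rpow_one_add (s := b / a - 1)
    (by have := div_nonneg hb ha.le; linarith) (p := q + 1) (by linarith)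
  rw [add_sub_cancel, Real.div_rpow hb ha.le, Real.rpow_add_one' hb (by linarith),
    Real.rpow_add_one' ha.le (by linarith)] at h
  have haq : 0 < a ^ q := Real.rpow_pos_of_pos ha q
  have h2 := mul_le_mul_of_nonneg_right h (mul_pos haq ha).le
  rw [div_mul_cancel₀ _ (mul_pos haq ha).ne'] at h2
  have h3 : (1 + (q + 1) * (b / a - 1)) * (a ^ q * a) =
      a ^ q * a + (q + 1) * (b - a) * a ^ q := by
    field_simp
  rw [h3] at h2
  linarith

/-- Monotone divided-difference bound for the odd power `x ↦ x |x| ^ q`. -/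
lemma sub_mul_abs_rpow_sub_le {q : ℝ} (hq : 0 ≤ q) (x y : ℝ) :
    (x - y) * (x * |x| ^ q - y * |y| ^ q) ≤ (q + 1) * (x - y) ^ 2 * (|x| ^ q + |y| ^ q) := by
  wlog h : |y| ≤ |x| generalizing x y
  · have := this y x (le_of_not_ge h)
    linarith
  have h1 := mul_rpow_sub_rpow_le hq (abs_nonneg y) h
  have hx : 0 ≤ |x| ^ q := by positivity
  have hy : 0 ≤ |y| ^ q := by positivity
  have hxy : 0 ≤ |x| ^ q - |y| ^ q := sub_nonneg.2 (Real.rpow_le_rpow (abs_nonneg y) h hq)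
  have h2 : (x - y) * y ≤ |x - y| * |y| := (le_abs_self _).trans (abs_mul _ _).le
  have h3 : |x| - |y| ≤ |x - y| := abs_sub_abs_le_abs_sub x y
  have h4 : (x - y) * y * (|x| ^ q - |y| ^ q) ≤ q * (x - y) ^ 2 * |x| ^ q :=
    calc _ ≤ |x - y| * |y| * (|x| ^ q - |y| ^ q) := by gcongr
      _ = |x - y| * (|y| * (|x| ^ q - |y| ^ q)) := by ring
      _ ≤ |x - y| * (q * |x - y| * |x| ^ q) := by
        refine mul_le_mul_of_nonneg_left (h1.trans ?_) (abs_nonneg _)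
        gcongr
      _ = q * (x - y) ^ 2 * |x| ^ q := by rw [← sq_abs (x - y)]; ring
  have h5 : 0 ≤ (q + 1) * (x - y) ^ 2 * |y| ^ q := by positivity
  linarith

/-- Young's inequality in the form used against Hölder-type trace terms. -/
lemma mul_mul_abs_rpow_le {K p : ℝ} (hK : 0 ≤ K) (hp : 2 ≤ p) (s x : ℝ) :
    K * (s * |x| ^ (p - 2)) ≤
      2 / p * (K ^ (p / 2) * |s| ^ (p / 2)) + (1 - 2 / p) * |x| ^ p := by
  have hp0 : 0 < p := by linarith
  have h := Real.geom_mean_le_arith_mean2_weighted (w₁ := 2 / p) (w₂ := 1 - 2 / p)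
    (p₁ := (K * |s|) ^ (p / 2)) (p₂ := |x| ^ p) (by positivity)
    (sub_nonneg.2 ((div_le_one hp0).2 hp)) (by positivity) (by positivity) (by ring)
  rw [← Real.rpow_mul (by positivity), ← Real.rpow_mul (by positivity),
    show p / 2 * (2 / p) = 1 by field_simp, show p * (1 - 2 / p) = p - 2 by field_simp,
    Real.rpow_one, Real.mul_rpow hK (abs_nonneg s)] at h
  refine le_trans ?_ h
  rw [← mul_assoc]
  gcongr
  exact le_abs_self s

end ScalarInequalities

section TraceInequalities

variable {m : Type*} [Fintype m] [DecidableEq m]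

/-- Noncommutative mean value inequality for the odd power `x ↦ x |x| ^ q`. -/
lemma trace_sub_mul_cfc_sub_le {q : ℝ} (hq : 0 ≤ q) {A B : Matrix m m ℂ}
    (hA : A.IsHermitian) (hB : B.IsHermitian) :
    (((A - B) * (cfc (fun x : ℝ => x * |x| ^ q) A - cfc (fun x : ℝ => x * |x| ^ q) B)).trace).re ≤
      (q + 1) * (((A - B) ^ 2 *
        (cfc (fun x : ℝ => |x| ^ q) A + cfc (fun x : ℝ => |x| ^ q) B)).trace).re := by
  obtain ⟨w, hw, hwt⟩ := exists_weights_trace_cfc_mul_cfc hA hB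
  have hAs : IsSelfAdjoint A := hA
  have hBs : IsSelfAdjoint B := hB
  set f : ℝ → ℝ := fun x => x * |x| ^ q with hf
  set g : ℝ → ℝ := fun x => |x| ^ q with hg
  have cA := continuousOn_spectrum_real A
  have cB := continuousOn_spectrum_real B
  have fA : cfc f A = A * cfc g A := by
    rw [hf, cfc_mul (fun x => x) g A (cA _) (cA _), cfc_id' ℝ A]
  have fB : cfc f B = cfc g B * B := by
    rw [hf, show (fun x : ℝ => x * |x| ^ q) = fun x => g x * x by ext; simp [hg, mul_comm],
      cfc_mul g (fun x => x) B (cB _) (cB _), cfc_id' ℝ B]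
  have commA : cfc g A * A = A * cfc g A := by
    rw [← fA, hf, show (fun x : ℝ => x * |x| ^ q) = fun x => g x * x by ext; simp [hg, mul_comm],
      cfc_mul g (fun x => x) A (cA _) (cA _), cfc_id' ℝ A]
  have commB : B * cfc g B = cfc g B * B := by
    rw [← fB, hf, cfc_mul (fun x => x) g B (cB _) (cB _), cfc_id' ℝ B]
  have idA : cfc (fun x : ℝ => x) A = A := cfc_id' ℝ A
  have idB : cfc (fun x : ℝ => x) B = B := cfc_id' ℝ B
  have oneA : cfc (fun _ : ℝ => (1 : ℝ)) A = 1 := cfc_const_one ℝ A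
  have oneB : cfc (fun _ : ℝ => (1 : ℝ)) B = 1 := cfc_const_one ℝ B
  have sqA : cfc (fun x : ℝ => x ^ 2) A = A ^ 2 := cfc_pow_id A 2
  have sqB : cfc (fun x : ℝ => x ^ 2) B = B ^ 2 := cfc_pow_id B 2
  have gA2 : cfc (fun x => x ^ 2 * g x) A = A ^ 2 * cfc g A := by
    rw [cfc_mul (fun x => x ^ 2) g A (cA _) (cA _), sqA]
  have gB2 : cfc (fun x => x ^ 2 * g x) B = B ^ 2 * cfc g B := by
    rw [cfc_mul (fun x => x ^ 2) g B (cB _) (cB _), sqB]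
  have fA2 : cfc (fun x => x * f x) A = A * cfc f A := by
    rw [cfc_mul (fun x => x) f A (cA _) (cA _), idA]
  have fB2 : cfc (fun x => x * f x) B = B * cfc f B := by
    rw [cfc_mul (fun x => x) f B (cB _) (cB _), idB]
  have hL : ((A - B) * (cfc f A - cfc f B)).trace =
      (cfc (fun x => x * f x) A * cfc (fun _ : ℝ => (1 : ℝ)) B).trace
      - (cfc f A * cfc (fun x : ℝ => x) B).trace
      - (cfc (fun x : ℝ => x) A * cfc f B).trace
      + (cfc (fun _ : ℝ => (1 : ℝ)) A * cfc (fun x => x * f x) B).trace := by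
    rw [idA, idB, oneA, oneB, fA2, fB2, Matrix.trace_mul_comm (cfc f A) B]
    simp only [sub_mul, mul_sub, mul_one, one_mul, trace_sub]
    ring
  have hR : ((A - B) ^ 2 * (cfc g A + cfc g B)).trace =
      (cfc (fun x => x ^ 2 * g x) A * cfc (fun _ : ℝ => (1 : ℝ)) B).trace
      - 2 * (cfc f A * cfc (fun x : ℝ => x) B).trace
      + (cfc g A * cfc (fun x : ℝ => x ^ 2) B).trace
      + (cfc (fun x : ℝ => x ^ 2) A * cfc g B).trace
      - 2 * (cfc (fun x : ℝ => x) A * cfc f B).trace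
      + (cfc (fun _ : ℝ => (1 : ℝ)) A * cfc (fun x => x ^ 2 * g x) B).trace := by
    rw [idA, idB, oneA, oneB, sqA, sqB, gA2, gB2]
    have e1 : (A * B * cfc g A).trace = (cfc f A * B).trace := by
      rw [Matrix.trace_mul_comm, ← mul_assoc, commA, fA]
    have e2 : (B * A * cfc g A).trace = (cfc f A * B).trace := by
      rw [mul_assoc, Matrix.trace_mul_comm, fA]
    have e3 : (A * B * cfc g B).trace = (A * cfc f B).trace := by
      rw [mul_assoc, commB, fB]
    have e4 : (B * A * cfc g B).trace = (A * cfc f B).trace := by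
      rw [mul_assoc, Matrix.trace_mul_comm, mul_assoc, fB]
    have e5 : (B ^ 2 * cfc g A).trace = (cfc g A * B ^ 2).trace := Matrix.trace_mul_comm _ _
    have e6 : (A - B) ^ 2 = A ^ 2 - A * B - B * A + B ^ 2 := by noncomm_ring
    rw [e6]
    simp only [sub_mul, add_mul, mul_add, mul_one, one_mul, trace_sub, trace_add, e1, e2, e3, e4,
      e5]
    ring
  rw [hL, hR]
  simp only [Complex.add_re, Complex.sub_re, Complex.mul_re, Complex.re_ofNat, Complex.im_ofNat,
    zero_mul, sub_zero, hwt]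
  simp only [Finset.mul_sum, ← Finset.sum_add_distrib, ← Finset.sum_sub_distrib]
  refine Finset.sum_le_sum fun j _ => Finset.sum_le_sum fun k _ => ?_
  have h := mul_le_mul_of_nonneg_left
    (sub_mul_abs_rpow_sub_le hq (hA.eigenvalues j) (hB.eigenvalues k)) (hw j k)
  simp only [hf, hg]
  linarith

/-- Trace Young inequality. -/
lemma trace_mul_cfc_abs_rpow_le {K p : ℝ} (hK : 0 ≤ K) (hp : 2 ≤ p) {S X : Matrix m m ℂ}
    (hS : S.PosSemidef) (hX : X.IsHermitian) :
    K * ((S * cfc (fun x : ℝ => |x| ^ (p - 2)) X).trace).re ≤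
      2 / p * (K ^ (p / 2) * ((cfc (fun s : ℝ => s ^ (p / 2)) S).trace).re) +
        (1 - 2 / p) * ((cfc (fun x : ℝ => |x| ^ p) X).trace).re := by
  obtain ⟨w, hw, hwt⟩ := exists_weights_trace_cfc_mul_cfc hS.isHermitian hX
  have hSs : IsSelfAdjoint S := hS.isHermitian
  have hXs : IsSelfAdjoint X := hX
  have h1 : ((cfc (fun s : ℝ => s ^ (p / 2)) S).trace).re =
      ((cfc (fun s : ℝ => |s| ^ (p / 2)) S * cfc (fun _ : ℝ => (1 : ℝ)) X).trace).re := by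
    rw [cfc_const_one ℝ X, mul_one, trace_cfc_eq_sum hS.isHermitian,
      trace_cfc_eq_sum hS.isHermitian]
    exact Finset.sum_congr rfl fun i _ => by rw [abs_of_nonneg (hS.eigenvalues_nonneg i)]
  have h2 : cfc (fun x : ℝ => |x| ^ p) X =
      cfc (fun _ : ℝ => (1 : ℝ)) S * cfc (fun x : ℝ => |x| ^ p) X := by
    rw [cfc_const_one ℝ S, one_mul]
  rw [h1, h2]
  conv_lhs => rw [← cfc_id' ℝ S]
  simp only [hwt, Finset.mul_sum, ← Finset.sum_add_distrib]
  refine Finset.sum_le_sum fun j _ => Finset.sum_le_sum fun k _ => ?_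
  have h := mul_le_mul_of_nonneg_left
    (mul_mul_abs_rpow_le hK hp (hS.isHermitian.eigenvalues j) (hX.eigenvalues k)) (hw j k)
  linarith

end TraceInequalities

section Rademacher

variable {m : Type*} [Fintype m] [DecidableEq m] {n : ℕ}

/-- The signed sum `∑ i, ε i • A i`. -/
noncomputable def signedSum {k l : Type*} (A : Fin n → Matrix k l ℂ) (ε : Fin n → ℤˣ) :
    Matrix k l ℂ :=
  ∑ i, ((ε i : ℤ) : ℂ) • A i

lemma isHermitian_signedSum {k : Type*} {A : Fin n → Matrix k k ℂ} (hA : ∀ i, (A i).IsHermitian)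
    (ε : Fin n → ℤˣ) : (signedSum A ε).IsHermitian := by
  rw [IsHermitian, signedSum, conjTranspose_sum]
  refine Finset.sum_congr rfl fun i _ => ?_
  rw [conjTranspose_smul, (hA i).eq]
  simp

lemma signedSum_sub_update_neg {k l : Type*} (A : Fin n → Matrix k l ℂ) (ε : Fin n → ℤˣ) (i : Fin n) :
    signedSum A ε - signedSum A (Function.update ε i (-ε i)) =
      (2 * ((ε i : ℤ) : ℂ)) • A i := by
  rw [signedSum, signedSum, ← Finset.sum_sub_distrib, Finset.sum_eq_single i]
  · simp [two_mul, add_smul]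
  · intro j _ hj
    simp [Function.update_of_ne hj]
  · simp

lemma sum_update_neg {M : Type*} [AddCommMonoid M] (F : (Fin n → ℤˣ) → M) (i : Fin n) :
    ∑ ε, F (Function.update ε i (-ε i)) = ∑ ε, F ε := by
  have hinv : Function.Involutive fun ε : Fin n → ℤˣ => Function.update ε i (-ε i) := by
    intro ε
    simp
  exact Equiv.sum_comp hinv.toPerm F

/-- Discrete integration by parts on the cube followed by the mean value inequality. -/
lemma sum_trace_smul_mul_cfc_le {q : ℝ} (hq : 0 ≤ q) {A : Fin n → Matrix m m ℂ}
    (hA : ∀ i, (A i).IsHermitian) (i : Fin n) :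
    ∑ ε, (((((ε i : ℤ) : ℂ) • A i) *
        cfc (fun x : ℝ => x * |x| ^ q) (signedSum A ε)).trace).re ≤
      2 * (q + 1) * ∑ ε, ((A i ^ 2 * cfc (fun x : ℝ => |x| ^ q) (signedSum A ε)).trace).re := by
  set f : ℝ → ℝ := fun x => x * |x| ^ q
  set g : ℝ → ℝ := fun x => |x| ^ q
  set F : (Fin n → ℤˣ) → ℝ := fun ε =>
    (((((ε i : ℤ) : ℂ) • A i) * cfc f (signedSum A ε)).trace).re with hF
  set G : (Fin n → ℤˣ) → ℝ := fun ε => ((A i ^ 2 * cfc g (signedSum A ε)).trace).re with hG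
  have key : ∀ ε, 2 * (F ε + F (Function.update ε i (-ε i))) ≤
      (q + 1) * (4 * (G ε + G (Function.update ε i (-ε i)))) := by
    intro ε
    have h := trace_sub_mul_cfc_sub_le hq (isHermitian_signedSum hA ε)
      (isHermitian_signedSum hA (Function.update ε i (-ε i)))
    have hsq : ((2 * ((ε i : ℤ) : ℂ)) • A i) ^ 2 = (4 : ℂ) • A i ^ 2 := by
      rcases Int.units_eq_one_or (ε i) with h | h <;> rw [h, smul_pow] <;> norm_num
    rw [signedSum_sub_update_neg, hsq] at h
    have e1 : (((2 * ((ε i : ℤ) : ℂ)) • A i * (cfc f (signedSum A ε) -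
        cfc f (signedSum A (Function.update ε i (-ε i))))).trace).re =
        2 * (F ε + F (Function.update ε i (-ε i))) := by
      rw [mul_smul, smul_mul_assoc, mul_sub, trace_smul, trace_sub]
      simp [hF]
      ring
    have e2 : (((4 : ℂ) • A i ^ 2 * (cfc g (signedSum A ε) +
        cfc g (signedSum A (Function.update ε i (-ε i))))).trace).re =
        4 * (G ε + G (Function.update ε i (-ε i))) := by
      rw [smul_mul_assoc, mul_add, trace_smul, trace_add]
      simp [hG]
    rwa [e1, e2] at h
  have hsum := Finset.sum_le_sum fun ε (_ : ε ∈ Finset.univ) => key ε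
  simp only [← Finset.mul_sum, Finset.sum_add_distrib, sum_update_neg F i,
    sum_update_neg G i] at hsum
  linarith

/-- Self-adjoint matrix Khintchine inequality, in trace form. -/
theorem sum_trace_abs_rpow_signedSum_le {p : ℝ} (hp : 2 ≤ p) {A : Fin n → Matrix m m ℂ}
    (hA : ∀ i, (A i).IsHermitian) :
    ∑ ε, ((cfc (fun x : ℝ => |x| ^ p) (signedSum A ε)).trace).re ≤
      2 ^ n * ((2 * (p - 1)) ^ (p / 2) *
        ((cfc (fun s : ℝ => s ^ (p / 2)) (∑ i, A i ^ 2)).trace).re) := by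
  have hp0 : 0 < p := by linarith
  have hq : 0 ≤ p - 2 := by linarith
  set K : ℝ := 2 * (p - 1) with hK
  have hK0 : 0 ≤ K := by linarith
  set M := ∑ ε, ((cfc (fun x : ℝ => |x| ^ p) (signedSum A ε)).trace).re with hM
  set N := ((cfc (fun s : ℝ => s ^ (p / 2)) (∑ i, A i ^ 2)).trace).re
  have hS : (∑ i, A i ^ 2).PosSemidef := by
    refine posSemidef_sum _ fun i _ => ?_
    have := posSemidef_conjTranspose_mul_self (A i)
    rwa [(hA i).eq, ← sq] at this
  have hsplit : ∀ ε, ((cfc (fun x : ℝ => |x| ^ p) (signedSum A ε)).trace).re =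
      ∑ i, (((((ε i : ℤ) : ℂ) • A i) *
        cfc (fun x : ℝ => x * |x| ^ (p - 2)) (signedSum A ε)).trace).re := by
    intro ε
    have hXs : IsSelfAdjoint (signedSum A ε) := isHermitian_signedSum hA ε
    have hfun : (fun x : ℝ => |x| ^ p) = fun x => x * (x * |x| ^ (p - 2)) := by
      ext x
      rw [← mul_assoc, ← abs_mul_abs_self x, ← sq, ← Real.rpow_natCast,
        ← Real.rpow_add' (abs_nonneg x) (by push_cast; linarith)]
      congr 1
      push_cast
      ring
    rw [hfun, cfc_mul (fun x => x) (fun x => x * |x| ^ (p - 2)) _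
      (continuousOn_spectrum_real _ _) (continuousOn_spectrum_real _ _),
      cfc_id' ℝ (signedSum A ε), ← Complex.re_sum, ← trace_sum, ← Finset.sum_mul]
    rfl
  have h1 : M ≤ K * ∑ ε, (((∑ i, A i ^ 2) *
      cfc (fun x : ℝ => |x| ^ (p - 2)) (signedSum A ε)).trace).re := by
    rw [hM, Finset.sum_congr rfl fun ε _ => hsplit ε, Finset.sum_comm]
    simp only [Finset.sum_mul, trace_sum, Complex.re_sum]
    rw [Finset.sum_comm (γ := Fin n → ℤˣ), Finset.mul_sum]
    refine Finset.sum_le_sum fun i _ => ?_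
    have := sum_trace_smul_mul_cfc_le hq hA i
    rwa [show 2 * (p - 2 + 1) = K by rw [hK]; ring] at this
  have h2 : K * ∑ ε, (((∑ i, A i ^ 2) *
      cfc (fun x : ℝ => |x| ^ (p - 2)) (signedSum A ε)).trace).re ≤
      2 ^ n * (2 / p * (K ^ (p / 2) * N)) + (1 - 2 / p) * M := by
    rw [hM, Finset.mul_sum, Finset.mul_sum]
    refine (Finset.sum_le_sum fun ε _ =>
      trace_mul_cfc_abs_rpow_le hK0 hp hS (isHermitian_signedSum hA ε)).trans_eq ?_
    rw [Finset.sum_add_distrib]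
    simp [N]
  have h3 : 2 / p * M ≤ 2 / p * (2 ^ n * (K ^ (p / 2) * N)) := by linarith
  exact le_of_mul_le_mul_left h3 (by positivity)

/-- Matrix Khintchine inequality in trace form for arbitrary square matrices, via the Hermitian
dilation. -/
theorem sum_trace_rpow_signedSum_le {p : ℝ} (hp : 2 ≤ p) (a : Fin n → Matrix m m ℂ) :
    ∑ ε, ((cfc (fun s : ℝ => s ^ (p / 2)) ((signedSum a ε)ᴴ * signedSum a ε)).trace).re ≤
      2 ^ n * ((2 * (p - 1)) ^ (p / 2) *
        (((cfc (fun s : ℝ => s ^ (p / 2)) (∑ i, (a i)ᴴ * a i)).trace).re +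
          ((cfc (fun s : ℝ => s ^ (p / 2)) (∑ i, a i * (a i)ᴴ)).trace).re)) := by
  set A : Fin n → Matrix (m ⊕ m) (m ⊕ m) ℂ := fun i => fromBlocks 0 (a i) (a i)ᴴ 0 with hAdef
  have hA : ∀ i, (A i).IsHermitian := fun i => isHermitian_zero.fromBlocks rfl isHermitian_zero
  have hX : ∀ ε, signedSum A ε = fromBlocks 0 (signedSum a ε) (signedSum a ε)ᴴ 0 := by
    intro ε
    ext (i | i) (j | j) <;>
      simp [signedSum, hAdef, Matrix.sum_apply, conjTranspose_apply]
  have hsq : ∑ i, A i ^ 2 = fromBlocks (∑ i, a i * (a i)ᴴ) 0 0 (∑ i, (a i)ᴴ * a i) := by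
    have : ∀ i, A i ^ 2 = fromBlocks (a i * (a i)ᴴ) 0 0 ((a i)ᴴ * a i) := fun i => by
      simp [hAdef, sq, fromBlocks_multiply]
    simp only [this]
    ext (i | i) (j | j) <;> simp [Matrix.sum_apply]
  have h := sum_trace_abs_rpow_signedSum_le hp hA
  have hR : (∑ i, a i * (a i)ᴴ).PosSemidef :=
    posSemidef_sum _ fun i _ => posSemidef_self_mul_conjTranspose (a i)
  have hC : (∑ i, (a i)ᴴ * a i).PosSemidef :=
    posSemidef_sum _ fun i _ => posSemidef_conjTranspose_mul_self (a i)
  rw [hsq, trace_cfc_fromBlocks hR.isHermitian hC.isHermitian] at h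
  rw [add_comm (((cfc _ (∑ i, (a i)ᴴ * a i)).trace).re)]
  refine le_trans (Finset.sum_le_sum fun ε _ => ?_) h
  set x := signedSum a ε
  have hs : IsSelfAdjoint (signedSum A ε) := isHermitian_signedSum hA ε
  have hfun : (fun y : ℝ => |y| ^ p) = fun y => (fun s : ℝ => s ^ (p / 2)) (y ^ 2) := by
    ext y
    beta_reduce
    rw [← sq_abs, ← Real.rpow_natCast, ← Real.rpow_mul (abs_nonneg y)]
    congr 1
    push_cast
    ring
  rw [hfun, cfc_comp_pow (fun s : ℝ => s ^ (p / 2)) 2 (signedSum A ε)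
    ((finite_real_spectrum.image _).continuousOn _), hX, sq, fromBlocks_multiply]
  simp only [zero_mul, mul_zero, zero_add, add_zero]
  rw [trace_cfc_fromBlocks (posSemidef_self_mul_conjTranspose x).isHermitian
    (posSemidef_conjTranspose_mul_self x).isHermitian]
  have := trace_cfc_nonneg (posSemidef_self_mul_conjTranspose x)
    (f := fun s : ℝ => s ^ (p / 2)) fun s hs => Real.rpow_nonneg hs _
  linarith

end Rademacher

lemma schattenNorm_cfc_sqrt {d : ℕ} {p : ℝ} {S : Matrix (Fin d) (Fin d) ℂ} (hS : S.PosSemidef) :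
    schattenNorm d p (cfc Real.sqrt S) = (((mpow d S (p / 2)).trace).re) ^ (1 / p) := by
  have hs : IsSelfAdjoint S := hS.isHermitian
  have hsa : (cfc Real.sqrt S)ᴴ = cfc Real.sqrt S := cfc_predicate Real.sqrt S
  have hmul : cfc Real.sqrt S * cfc Real.sqrt S = S := by
    rw [← cfc_mul Real.sqrt Real.sqrt S (continuousOn_spectrum_real _ _)
      (continuousOn_spectrum_real _ _)]
    conv_rhs => rw [← cfc_id' ℝ S]
    refine cfc_congr fun x hx => Real.mul_self_sqrt ?_
    rw [hS.isHermitian.spectrum_real_eq_range_eigenvalues] at hx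
    obtain ⟨i, rfl⟩ := hx
    exact hS.eigenvalues_nonneg i
  rw [schattenNorm, hsa, hmul]

end ComplexOrder

/-- **Noncommutative Khintchine-type inequality with constant O(p)** (Section 5.1):
for matrices `a₁,…,a_n ∈ M_d(ℂ)` and `p = 2` or `p ≥ 3`, the average over sign
vectors `ε ∈ {−1,1}ⁿ` (encoded as `ε : Fin n → ℤˣ`) satisfies
`(2^{−n}·Σ_ε Tr(((Σ ε_i a_i)ᴴ·(Σ ε_i a_i))^{p/2}))^{1/p}
  ≤ (p/√2)·(‖(Σ a_iᴴa_i)^{1/2}‖_{S_p} + ‖(Σ a_ia_iᴴ)^{1/2}‖_{S_p})`. -/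
theorem noncommutative_khintchine (d n : ℕ) (hd : 1 ≤ d) (hn : 1 ≤ n)
    (a : Fin n → Matrix (Fin d) (Fin d) ℂ)
    (p : ℝ) (hp : p = 2 ∨ 3 ≤ p) :
    (((2 : ℝ) ^ n)⁻¹ *
        ∑ ε : Fin n → ℤˣ,
          (Matrix.trace (mpow d
            ((∑ i, ((ε i : ℤ) : ℂ) • a i)ᴴ * (∑ i, ((ε i : ℤ) : ℂ) • a i))
            (p / 2))).re) ^ (1 / p) ≤
      (p / Real.sqrt 2) *
        (schattenNorm d p (cfc Real.sqrt (∑ i, (a i)ᴴ * a i)) +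
         schattenNorm d p (cfc Real.sqrt (∑ i, a i * (a i)ᴴ))) := by
  have hp2 : 2 ≤ p := by rcases hp with h | h <;> linarith
  have hp0 : 0 < p := by linarith
  open scoped ComplexOrder in
  have hR : (∑ i, a i * (a i)ᴴ).PosSemidef :=
    posSemidef_sum _ fun i _ => posSemidef_self_mul_conjTranspose (a i)
  open scoped ComplexOrder in
  have hC : (∑ i, (a i)ᴴ * a i).PosSemidef :=
    posSemidef_sum _ fun i _ => posSemidef_conjTranspose_mul_self (a i)
  have hpow : ∀ s : ℝ, 0 ≤ s → 0 ≤ s ^ (p / 2) := fun s hs => Real.rpow_nonneg hs _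
  have hmain := sum_trace_rpow_signedSum_le hp2 a
  rw [schattenNorm_cfc_sqrt hC, schattenNorm_cfc_sqrt hR]
  simp only [signedSum] at hmain
  simp only [mpow]
  open scoped ComplexOrder in
  have hc0 := trace_cfc_nonneg hC hpow
  open scoped ComplexOrder in
  have hr0 := trace_cfc_nonneg hR hpow
  open scoped ComplexOrder in
  have hl0 := Finset.sum_nonneg fun (ε : Fin n → ℤˣ) (_ : ε ∈ Finset.univ) =>
    trace_cfc_nonneg (posSemidef_conjTranspose_mul_self (∑ i, ((ε i : ℤ) : ℂ) • a i)) hpow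
  generalize ((cfc (fun s : ℝ => s ^ (p / 2)) (∑ i, (a i)ᴴ * a i)).trace).re = c at *
  generalize ((cfc (fun s : ℝ => s ^ (p / 2)) (∑ i, a i * (a i)ᴴ)).trace).re = r at *
  generalize ∑ ε : Fin n → ℤˣ, ((cfc (fun s : ℝ => s ^ (p / 2))
    ((∑ i, ((ε i : ℤ) : ℂ) • a i)ᴴ * ∑ i, ((ε i : ℤ) : ℂ) • a i)).trace).re = L at *
  have hconst : (2 * (p - 1)) ^ (p / 2) ≤ (p / Real.sqrt 2) ^ p := by
    have hs : (p / Real.sqrt 2) ^ p = ((p / Real.sqrt 2) ^ 2) ^ (p / 2) := by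
      rw [← Real.rpow_natCast, ← Real.rpow_mul (by positivity)]
      congr 1
      push_cast
      ring
    rw [hs, div_pow, Real.sq_sqrt zero_le_two]
    exact Real.rpow_le_rpow (by linarith) (by nlinarith [sq_nonneg (p - 2)]) (by positivity)
  calc ((2 ^ n)⁻¹ * L) ^ (1 / p)
      ≤ ((p / Real.sqrt 2) ^ p * (c + r)) ^ (1 / p) := by
        refine Real.rpow_le_rpow (by positivity) ?_ (by positivity)
        rw [inv_mul_le_iff₀ (by positivity)]
        exact hmain.trans (by gcongr)
    _ = p / Real.sqrt 2 * (c + r) ^ (1 / p) := by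
        rw [Real.mul_rpow (by positivity) (by positivity), one_div,
          Real.rpow_rpow_inv (by positivity) hp0.ne']
    _ ≤ p / Real.sqrt 2 * (c ^ (1 / p) + r ^ (1 / p)) := by
        gcongr
        exact Real.rpow_add_le_add_rpow hc0 hr0 (by positivity)
          ((div_le_one hp0).2 (by linarith))
end
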